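/- If π is a partition of {1,...,m} (induced by a cyclic sequence as above) with a crossing, and J = ∅, then the Cayley length of the associated permutation h(π) satisfies |h(π)| ≥ 2|π| − m. -/

import Mathlib

open Finset

/-- `x` and `y` lie in the same block of the partition `π`. -/
def SameBlock {α : Type*} [DecidableEq α] {s : Finset α} (π : Finpartition s)
    (x y : α) : Prop :=
  ∃ B ∈ π.parts, x ∈ B ∧ y ∈ B

/-- A partition of `{1,…,n}` (modelled on `Fin n`) is noncrossing if whenever
`a < b < c < d` with `a,c` in one block and `b,d` in one block, all four lie in a
common block. -/
def Noncrossing {n : ℕ} (π : Finpartition (univ : Finset (Fin n))) : Prop :=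
  ∀ a b c d : Fin n, a < b → b < c → c < d →
    SameBlock π a c → SameBlock π b d → SameBlock π a b

/-- The position of a point in the interleaved sequence `1,1',2,2',…,n,n'`:
`(i, false)` is the point `i+1` and `(i, true)` is the primed point `(i+1)'`. -/
def interPos {n : ℕ} (x : Fin n × Bool) : ℕ :=
  2 * x.1.val + (if x.2 then 1 else 0)

/-- Same-block relation for the union of a partition `π` of the unprimed points with a
partition `κ` of the primed points. -/
def UnionRel {n : ℕ} (π κ : Finpartition (univ : Finset (Fin n)))
    (x y : Fin n × Bool) : Prop :=
  x.2 = y.2 ∧ (if x.2 = true then SameBlock κ x.1 y.1 else SameBlock π x.1 y.1)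

/-- `π ∪ κ` is a noncrossing partition of the interleaved points `1,1',2,2',…,n,n'`. -/
def UnionNoncrossing {n : ℕ} (π κ : Finpartition (univ : Finset (Fin n))) : Prop :=
  ∀ a b c d : Fin n × Bool,
    interPos a < interPos b → interPos b < interPos c → interPos c < interPos d →
    UnionRel π κ a c → UnionRel π κ b d → UnionRel π κ a b

/-- `κ` is the Kreweras complement of `π`: it is the maximal partition of the primed
points `1',…,n'` such that `π ∪ κ` is noncrossing on the interleaved points. -/
def IsKreweras {n : ℕ} (π κ : Finpartition (univ : Finset (Fin n))) : Prop :=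
  UnionNoncrossing π κ ∧
    ∀ κ' : Finpartition (univ : Finset (Fin n)), UnionNoncrossing π κ' → κ' ≤ κ

/-- The Cayley length of a permutation: the minimal number of transpositions needed to
express it as a product. -/
noncomputable def cayleyLength {α : Type*} [DecidableEq α] (σ : Equiv.Perm α) : ℕ :=
  sInf {l | ∃ L : List (Equiv.Perm α), L.length = l ∧
    (∀ τ ∈ L, ∃ a b, a ≠ b ∧ τ = Equiv.swap a b) ∧ L.prod = σ}

/-- The kernel partition of a sequence `i : Fin m → Fin q`: positions `j, l` are in the
same block iff `i j = i l`. -/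
def kernelPartition {m q : ℕ} (i : Fin m → Fin q) :
    Finpartition (univ : Finset (Fin m)) :=
  @Finpartition.ofSetoid (Fin m) _ _ (Setoid.ker i)
    (fun a b => inferInstanceAs (Decidable (i a = i b)))

/-- The cyclic product of transpositions `(i₁ i₂)(i₂ i₃)⋯(i_{m-1} i_m)(i_m i₁)`
associated with the sequence `i`. -/
def cyclicProd {m q : ℕ} (i : Fin m → Fin q) : Equiv.Perm (Fin q) :=
  ((List.finRange m).map fun j => Equiv.swap (i j) (i (finRotate m j))).prod

/-- `Fac l σ`: `σ` is a product of `l` (possibly trivial) swaps. -/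
inductive Fac {α : Type*} [DecidableEq α] : ℕ → Equiv.Perm α → Prop
  | one : Fac 0 1
  | mul (l : ℕ) (σ : Equiv.Perm α) (a b : α) : Fac l σ → Fac (l + 1) (Equiv.swap a b * σ)

/-- Product of the swaps along a path. -/
def pathProd {α : Type*} [DecidableEq α] : List α → Equiv.Perm α
  | [] => 1
  | [_] => 1
  | a :: b :: l => Equiv.swap a b * pathProd (b :: l)

section
variable {α : Type*} [DecidableEq α]

lemma Fac.reduce {l : ℕ} {ρ : Equiv.Perm α} (h : Fac l ρ) (x : α) (hx : ρ x ≠ x) :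
    ∃ l', l = l' + 1 ∧ Fac l' (Equiv.swap x (ρ x) * ρ) := by
  induction h with
  | one => simp at hx
  | mul l σ a b hσ ih =>
    refine ⟨l, rfl, ?_⟩
    by_cases h1 : σ x = x
    · have h2 : Equiv.swap x (Equiv.swap a b x) = Equiv.swap a b := by
        simp only [Equiv.Perm.mul_apply, h1] at hx
        rcases Equiv.swap_apply_eq_iff.not.mp hx |> fun _ => (em (x = a)) with rfl | ha
        · simp
        · rcases em (x = b) with rfl | hb
          · simp [Equiv.swap_comm]
          · exact absurd (Equiv.swap_apply_of_ne_of_ne ha hb) hx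
      rw [Equiv.Perm.mul_apply, h1, h2, ← mul_assoc, Equiv.swap_mul_self, one_mul]
      exact hσ
    · obtain ⟨l', rfl, hf⟩ := ih h1
      set y := σ x with hy
      have key : ∃ c d, Equiv.swap x (Equiv.swap a b y) * Equiv.swap a b =
          Equiv.swap c d * Equiv.swap x y := by
        have hx' : Equiv.swap a b y ≠ x := by simpa [← hy] using hx
        by_cases hfix : Equiv.swap a b x = x
        · refine ⟨a, b, ?_⟩
          have := Equiv.mul_swap_eq_swap_mul (Equiv.swap a b) x y
          rw [this, hfix]
        · have : ∃ w, w ≠ x ∧ Equiv.swap a b = Equiv.swap x w := by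
            rcases em (x = a) with rfl | ha
            · exact ⟨b, by rintro rfl; simp at hfix, rfl⟩
            · rcases em (x = b) with rfl | hb
              · exact ⟨a, Ne.symm ha, Equiv.swap_comm _ _⟩
              · exact absurd (Equiv.swap_apply_of_ne_of_ne ha hb) hfix
          obtain ⟨w, hw, e⟩ := this
          rw [e] at hx' ⊢
          have hwy : y ≠ w := by rintro rfl; simp at hx'
          have e2 : Equiv.swap x w y = y := Equiv.swap_apply_of_ne_of_ne h1 hwy
          rw [e2]
          refine ⟨y, w, ?_⟩
          have := Equiv.mul_swap_eq_swap_mul (Equiv.swap x y) x w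
          rw [this, Equiv.swap_apply_left, Equiv.swap_apply_of_ne_of_ne hw hwy.symm]
      obtain ⟨c, d, e⟩ := key
      rw [Equiv.Perm.mul_apply, ← hy, ← mul_assoc, e, mul_assoc]
      exact Fac.mul _ _ _ _ hf

lemma Fac.reduce' {l : ℕ} {σ : Equiv.Perm α} {x w : α} (h : Fac l (Equiv.swap x w * σ))
    (hx : σ x = x) (hw : w ≠ x) : ∃ l', l = l' + 1 ∧ Fac l' σ := by
  have := h.reduce x (by simpa [hx] using hw)
  simpa [hx] using this

lemma Fac.of_list (L : List (Equiv.Perm α))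
    (hL : ∀ τ ∈ L, ∃ a b, a ≠ b ∧ τ = Equiv.swap a b) : Fac L.length L.prod := by
  induction L with
  | nil => exact Fac.one
  | cons τ L ih =>
    obtain ⟨a, b, -, e⟩ := hL τ (by simp)
    rw [List.prod_cons, e]
    exact Fac.mul _ _ _ _ (ih fun τ h => hL τ (by simp [h]))

lemma pathProd_append (u : List α) (y : α) (v : List α) :
    pathProd (u ++ y :: v) = pathProd (u ++ [y]) * pathProd (y :: v) := by
  induction u with
  | nil => simp [pathProd]
  | cons a u ih =>
    cases u with
    | nil => simp [pathProd]
    | cons b u => simp only [List.cons_append, pathProd] at ih ⊢; rw [ih, mul_assoc]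

lemma pathProd_fix (L : List α) (x : α) (hx : x ∉ L) : pathProd L x = x := by
  induction L with
  | nil => simp [pathProd]
  | cons a u ih =>
    cases u with
    | nil => simp [pathProd]
    | cons b u =>
      simp only [List.mem_cons, not_or] at hx ih
      simp only [pathProd, Equiv.Perm.mul_apply]
      rw [ih (by simp [hx]), Equiv.swap_apply_of_ne_of_ne hx.1 hx.2.1]

lemma pathProd_sign [Fintype α] (L : List α) (h : L.IsChain (· ≠ ·)) (hL : L ≠ []) :
    Equiv.Perm.sign (pathProd L) = (-1) ^ (L.length + 1) := by
  induction L with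
  | nil => simp at hL
  | cons a u ih =>
    cases u with
    | nil => simp [pathProd]
    | cons b u =>
      rw [List.isChain_cons_cons] at h
      simp only [pathProd, Equiv.Perm.sign_mul, Equiv.Perm.sign_swap h.1]
      rw [ih h.2 (by simp)]
      simp [pow_succ]

lemma sublist_dedup {s u v : List α} {x : α} (hs : s.IsChain (· ≠ ·))
    (h : s.Sublist (u ++ x :: x :: v)) : s.Sublist (u ++ x :: v) := by
  obtain ⟨s1, s2, rfl, h1, h2⟩ := List.sublist_append_iff.mp h
  refine h1.append ?_
  have hs2 := hs.right_of_append
  rcases List.sublist_cons_iff.mp h2 with h3 | ⟨t, rfl, h3⟩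
  · exact h3
  · rcases List.sublist_cons_iff.mp h3 with h | ⟨t', rfl, h⟩
    · exact h.cons_cons x
    · simp at hs2

lemma exists_dup (L : List α) (h : ¬ L.IsChain (· ≠ ·)) :
    ∃ u x v, L = u ++ x :: x :: v := by
  induction L with
  | nil => simp at h
  | cons a l ih =>
    cases l with
    | nil => simp at h
    | cons b l =>
      by_cases hab : a = b
      · exact ⟨[], a, l, by simp [hab]⟩
      · rw [List.isChain_cons_cons] at h
        obtain ⟨u, x, v, e⟩ := ih (fun h' => h ⟨hab, h'⟩)
        exact ⟨a :: u, x, v, by simp [e]⟩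

lemma card_singleton (u v : List α) (x : α) (hu : x ∉ u) (hv : x ∉ v) :
    (u ++ x :: v).toFinset.card = (u ++ v).toFinset.card + 1 := by
  have : (u ++ x :: v).toFinset = insert x (u ++ v).toFinset := by ext; simp
  rw [this, Finset.card_insert_of_notMem (by simp [hu, hv])]

lemma main_bound [Fintype α] (a b : α) (hab : a ≠ b) : ∀ (k : ℕ) (L : List α), L.length = k →
    [a, b, a, b].Sublist L → ∀ l, Fac l (pathProd L) →
    2 * L.toFinset.card + 1 ≤ l + k := by
  have hch : [a, b, a, b].IsChain (· ≠ ·) := by simp [hab, hab.symm]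
  intro k
  induction k using Nat.strong_induction_on with
  | _ k ih =>
  intro L hk hs l hf
  by_cases hc : L.IsChain (· ≠ ·)
  swap
  · obtain ⟨u, x, v, rfl⟩ := exists_dup L hc
    have hs' := sublist_dedup hch hs
    have e : pathProd (u ++ x :: x :: v) = pathProd (u ++ x :: v) := by
      rw [pathProd_append, pathProd_append u x v]; simp [pathProd, ← Equiv.Perm.one_def]
    rw [e] at hf
    have := ih (u ++ x :: v).length (by simp at hk ⊢; omega) _ rfl hs' l hf
    have e2 : (u ++ x :: x :: v).toFinset = (u ++ x :: v).toFinset := by ext; simp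
    rw [e2]; simp at this hk ⊢; omega
  by_cases h1 : ∃ x ∈ L, L.count x < 2
  swap
  · push Not at h1
    have h2 : 2 * L.toFinset.card ≤ k := by
      rw [← hk, ← List.sum_toFinset_count_eq_length L, mul_comm]
      exact Finset.card_nsmul_le_sum L.toFinset (fun x => L.count x) 2
        (fun x hx => h1 x (List.mem_toFinset.mp hx))
    rcases Nat.eq_zero_or_pos l with rfl | hl
    · have h3 : pathProd L = 1 := by
        generalize pathProd L = σ at hf
        cases hf; rfl
      have h4 := pathProd_sign L hc (by rintro rfl; simp at hs)
      rw [h3, map_one, hk] at h4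
      have h5 : k ≠ 2 * L.toFinset.card := by
        intro h; rw [h, pow_succ, pow_mul] at h4; simp at h4
      omega
    · omega
  obtain ⟨x, hxL, hx⟩ := h1
  obtain ⟨u, v, rfl⟩ := List.append_of_mem hxL
  simp only [List.count_append, List.count_cons_self] at hx
  have hu : x ∉ u := List.count_eq_zero.mp (by omega)
  have hv : x ∉ v := List.count_eq_zero.mp (by omega)
  have hxs : ∀ c ∈ [a, b, a, b], c ≠ x := by
    rintro c hc1 rfl
    have h6 := hs.count_le c
    have h7 : 2 ≤ [a, b, a, b].count c := by
      simp at hc1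
      rcases hc1 with rfl | rfl | rfl | rfl <;> simp [List.count_cons] <;> omega
    simp only [List.count_append, List.count_cons_self] at h6
    omega
  have hs' : [a, b, a, b].Sublist (u ++ v) := by
    have h6 := hs.filter (fun c => decide (c ≠ x))
    have h7 : ∀ w : List α, (∀ c ∈ w, c ≠ x) → w.filter (fun c => decide (c ≠ x)) = w := by
      intro w hw; rw [List.filter_eq_self]; simpa using hw
    rw [List.filter_append, h7 _ hxs, h7 u (by rintro c hc1 rfl; exact hu hc1)] at h6
    rw [List.filter_cons_of_neg (by simp), h7 v (by rintro c hc1 rfl; exact hv hc1)] at h6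
    exact h6
  have hcard := card_singleton u v x hu hv
  rw [hcard]
  have hlen : (u ++ v).length + 1 = k := by simp at hk ⊢; omega
  -- generic finishing step
  have fin : ∀ w, w ≠ x → pathProd (u ++ x :: v) = Equiv.swap x w * pathProd (u ++ v) →
      2 * ((u ++ v).toFinset.card + 1) + 1 ≤ l + k := by
    intro w hw e
    rw [e] at hf
    obtain ⟨l', rfl, hf'⟩ := hf.reduce' (pathProd_fix _ x (by simp [hu, hv])) hw
    have := ih (u ++ v).length (by omega) _ rfl hs' l' hf'
    omega
  rcases List.eq_nil_or_concat' u with rfl | ⟨u, y, rfl⟩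
  · cases v with
    | nil => simp at hs'
    | cons z v =>
      refine fin z (by rintro rfl; simp at hv) (by simp [pathProd])
  · have hAx := pathProd_fix _ x hu
    have hne : ∀ z, z ≠ x → pathProd (u ++ [y]) z ≠ x := by
      intro z hz h; exact hz ((pathProd (u ++ [y])).injective (h.trans hAx.symm))
    have hy : y ≠ x := by rintro rfl; simp at hu
    cases v with
    | nil =>
      refine fin (pathProd (u ++ [y]) y) (hne y hy) ?_
      have := Equiv.mul_swap_eq_swap_mul (pathProd (u ++ [y])) x y
      rw [hAx] at this
      rw [List.append_nil, ← this, List.append_assoc, List.singleton_append, pathProd_append]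
      simp [pathProd, Equiv.swap_comm]
    | cons z v =>
      have hz : z ≠ x := by rintro rfl; simp at hv
      by_cases hyz : y = z
      · subst hyz
        have e : pathProd (u ++ [y] ++ x :: y :: v) = pathProd (u ++ y :: v) := by
          rw [List.append_assoc, List.singleton_append, pathProd_append, pathProd_append u y v]
          simp [pathProd, Equiv.swap_comm x y]
        rw [e] at hf
        have hs2 : [a, b, a, b].Sublist (u ++ y :: v) := by
          apply sublist_dedup hch; simpa using hs'
        have := ih (u ++ y :: v).length (by simp at hlen ⊢; omega) _ rfl hs2 l hf
        have e2 : (u ++ [y] ++ y :: v).toFinset = (u ++ y :: v).toFinset := by ext; simp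
        rw [e2]; simp at this hlen ⊢; omega
      · refine fin (pathProd (u ++ [y]) z) (hne z hz) ?_
        have h8 := Equiv.mul_swap_eq_swap_mul (pathProd (u ++ [y])) x z
        rw [hAx] at h8
        have h9 : Equiv.swap y x * Equiv.swap x z = Equiv.swap x z * Equiv.swap y z := by
          have := Equiv.mul_swap_eq_swap_mul (Equiv.swap x z) y z
          rw [this, Equiv.swap_apply_right, Equiv.swap_apply_of_ne_of_ne hy hyz]
        simp only [List.append_assoc, List.singleton_append]
        rw [pathProd_append, pathProd_append u y (z :: v), ← mul_assoc, ← h8]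
        simp only [pathProd]
        rw [mul_assoc, ← mul_assoc (Equiv.swap y x), h9, mul_assoc]

lemma pathProd_ofFn (n : ℕ) (f : Fin (n + 1) → α) : pathProd (List.ofFn f) =
    ((List.finRange n).map fun j => Equiv.swap (f j.castSucc) (f j.succ)).prod := by
  induction n with
  | zero => simp [pathProd]
  | succ n ih =>
    have := ih (fun j => f j.succ)
    rw [List.ofFn_succ, List.finRange_succ]
    rw [List.ofFn_succ] at this ⊢
    simp only [pathProd, List.map_cons, List.prod_cons, List.map_map, this]
    rfl

end

lemma sameBlock_kernel {m q : ℕ} (i : Fin m → Fin q) (a b : Fin m) :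
    SameBlock (kernelPartition i) a b ↔ i a = i b := by
  letI : DecidableRel (Setoid.ker i).r := fun a b => inferInstanceAs (Decidable (i a = i b))
  unfold SameBlock kernelPartition
  constructor
  · rintro ⟨B, hB, ha, hb⟩
    obtain ⟨c, -, rfl⟩ := Finset.mem_image.mp hB
    simp [Setoid.ker, Function.onFun] at ha hb
    exact ha.symm.trans hb
  · intro h
    refine ⟨_, (Finpartition.part_mem _).2 (mem_univ a), Finpartition.mem_part _ (mem_univ a), ?_⟩
    rw [Finpartition.mem_part_ofSetoid_iff_rel]
    exact h

lemma card_kernel {m q : ℕ} (i : Fin m → Fin q) :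
    (kernelPartition i).parts.card ≤ (univ.image i).card := by
  have : (kernelPartition i).parts ⊆ (univ.image i).image (fun c => univ.filter (fun j => c = i j)) := by
    intro B hB
    obtain ⟨c, -, rfl⟩ := Finset.mem_image.mp hB
    simp only [mem_image, mem_univ, true_and, exists_exists_eq_and]
    refine ⟨c, ?_⟩
    ext j
    simp [Setoid.ker, Function.onFun]
  exact (card_le_card this).trans card_image_le

/-- If the kernel partition `π` of the cyclic sequence `(i₁,…,i_m)`
(with cyclically adjacent entries distinct) has a crossing, then the Cayley length of
the associated permutation `h(π) = (i₁,i₂)(i₂,i₃)⋯(i_m,i₁)` satisfies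
`|h(π)| ≥ 2|π| − m`. -/
theorem stmt13 (m q : ℕ) (hm : 0 < m) (i : Fin m → Fin q)
    (hadj : ∀ j : Fin m, i j ≠ i (finRotate m j))
    (hcross : ∃ a b c d : Fin m, a < b ∧ b < c ∧ c < d ∧
      SameBlock (kernelPartition i) a c ∧ SameBlock (kernelPartition i) b d ∧
      ¬ SameBlock (kernelPartition i) a b) :
    (cayleyLength (cyclicProd i) : ℤ) ≥ 2 * (kernelPartition i).parts.card - m := by
  obtain ⟨a, b, c, d, hab, hbc, hcd, hac, hbd, hnab⟩ := hcross
  rw [sameBlock_kernel] at hac hbd hnab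
  have hcard := card_kernel i
  obtain ⟨n, rfl⟩ : ∃ n, m = n + 1 := ⟨m - 1, by omega⟩
  let L : List (Fin q) := List.ofFn (Fin.snoc i (i 0) : Fin (n + 1 + 1) → Fin q)
  have hP : cyclicProd i = pathProd L := by
    rw [pathProd_ofFn]
    unfold cyclicProd
    congr 1
    apply List.map_congr_left
    intro j _
    rw [Fin.snoc_castSucc]
    congr 1
    refine Fin.lastCases ?_ (fun j => ?_) j
    · rw [finRotate_last, Fin.succ_last, Fin.snoc_last]
    · rw [Fin.succ_castSucc, Fin.snoc_castSucc]
      congr 1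
      ext; simp [finRotate_succ_apply]
  have hLi : (List.ofFn i).Sublist L := by
    simp only [L]
    rw [List.ofFn_succ' (f := (Fin.snoc i (i 0) : Fin (n + 1 + 1) → Fin q))]
    simp
  have hs : [i a, i b, i a, i b].Sublist L := by
    refine List.Sublist.trans ?_ hLi
    have h0 : [a, b, c, d].Sublist (List.finRange (n + 1)) := by
      apply List.sublist_of_subperm_of_pairwise (r := (· < ·))
      · apply List.subperm_of_subset
        · simp; grind
        · intro x _; simp
      · simp; grind
      · exact List.pairwise_lt_finRange _
    have := h0.map i
    rw [List.ofFn_eq_map]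
    simpa [← hac, ← hbd] using this
  have hcard2 : (univ.image i).card ≤ L.toFinset.card := by
    apply card_le_card
    intro x hx
    simp only [mem_image, mem_univ, true_and] at hx
    obtain ⟨j, rfl⟩ := hx
    exact List.mem_toFinset.2 (hLi.subset (by rw [List.mem_ofFn]; exact ⟨j, rfl⟩))
  have hfac : Fac (cayleyLength (cyclicProd i)) (cyclicProd i) := by
    have hne : {l | ∃ L : List (Equiv.Perm (Fin q)), L.length = l ∧
        (∀ τ ∈ L, ∃ a b, a ≠ b ∧ τ = Equiv.swap a b) ∧ L.prod = cyclicProd i}.Nonempty := by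
      obtain ⟨L, h1, h2⟩ := Equiv.Perm.swapFactors (cyclicProd i)
      exact ⟨_, L, rfl, h2, h1⟩
    obtain ⟨L, h1, h2, h3⟩ := Nat.sInf_mem hne
    have := Fac.of_list L h2
    rw [h1, h3] at this
    exact this
  rw [hP] at hfac ⊢
  have := main_bound (i a) (i b) hnab _ L rfl hs _ hfac
  have hl : L.length = n + 1 + 1 := by simp [L]
  push_cast
  omega
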